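/- arXiv:2309.08941 — 2 statements merged into one kernel-verified Lean document; each statement's English description precedes it below -/
import Mathlib

section
/- Let Y be distributed according to the Haar (uniform) measure on the unit sphere S^{n-1} ⊂ ℝ^n. Then for all real c > 1 and any coordinate index 1 ≤ i ≤ n, Pr[Y[i]² ≤ n^{-3c}] ≤ 2 n^{1-c}. -/
open MeasureTheory

/-- A finite set of naturals whose pairwise differences are at most `L` has at most `L + 1`
elements. -/
lemma card_le_of_forall_sub_le (S : Finset ℕ) {L : ℝ} (hL : 0 ≤ L)
    (h : ∀ a ∈ S, ∀ b ∈ S, (a : ℝ) - b ≤ L) : (S.card : ℝ) ≤ L + 1 := by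
  rcases S.eq_empty_or_nonempty with rfl | hS
  · simp only [Finset.card_empty, Nat.cast_zero]; linarith
  · have hsub : S ⊆ Finset.Icc (S.min' hS) (S.max' hS) := fun a ha =>
      Finset.mem_Icc.2 ⟨S.min'_le a ha, S.le_max' a ha⟩
    have hcard := Finset.card_le_card hsub
    rw [Nat.card_Icc] at hcard
    have hmm : S.min' hS ≤ S.max' hS := S.min'_le_max' hS
    have hcast : (S.card : ℝ) ≤ (S.max' hS : ℝ) + 1 - S.min' hS := by
      have : S.card + S.min' hS ≤ S.max' hS + 1 := by omega
      have : (S.card : ℝ) + S.min' hS ≤ S.max' hS + 1 := by exact_mod_cast this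
      linarith
    linarith [h _ (S.max'_mem hS) _ (S.min'_mem hS)]

/-- A slab of half-width `δ` orthogonal to `y` contains few points of the grid `{1, …, N} ^ ι`, as
soon as one coordinate of `y` is at least `r` in absolute value. -/
lemma card_grid_slab_le {ι : Type*} [Fintype ι] [DecidableEq ι] (N : ℕ) (y : ι → ℝ) (j : ι)
    {r δ : ℝ} (hr : 0 < r) (hδ : 0 ≤ δ) (hj : r ≤ |y j|) :
    ((Finset.univ.filter fun u : ι → Fin N =>
      |∑ k, y k * ((u k : ℕ) + 1 : ℝ)| ≤ δ).card : ℝ) ≤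
      (N : ℝ) ^ (Fintype.card ι - 1) * (2 * δ / r + 1) := by
  set S := Finset.univ.filter fun u : ι → Fin N => |∑ k, y k * ((u k : ℕ) + 1 : ℝ)| ≤ δ
  let f : (ι → Fin N) → ({k // k ≠ j} → Fin N) := fun u k => u k
  have hfib : ∀ b, ((S.filter fun u => f u = b).card : ℝ) ≤ 2 * δ / r + 1 := by
    intro b
    have heq : ∀ u ∈ S.filter (fun u => f u = b), ∀ v ∈ S.filter (fun u => f u = b),
        ∀ k, k ≠ j → u k = v k := by
      intro u hu v hv k hk
      have h : f u = f v := (Finset.mem_filter.1 hu).2.trans (Finset.mem_filter.1 hv).2.symm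
      exact congrFun h ⟨k, hk⟩
    have hinj : Set.InjOn (fun u : ι → Fin N => (u j : ℕ)) (S.filter fun u => f u = b) := by
      intro u hu v hv huv
      funext k
      by_cases hk : k = j
      · subst hk; exact Fin.ext huv
      · exact heq u hu v hv k hk
    rw [← Finset.card_image_of_injOn hinj]
    refine card_le_of_forall_sub_le _ (by positivity) ?_
    simp only [Finset.mem_image]
    rintro _ ⟨u, hu, rfl⟩ _ ⟨v, hv, rfl⟩
    have hdiff : ∑ k, y k * ((u k : ℕ) + 1 : ℝ) - ∑ k, y k * ((v k : ℕ) + 1 : ℝ) =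
        y j * ((u j : ℕ) - (v j : ℕ) : ℝ) := by
      rw [← Finset.sum_sub_distrib, Finset.sum_eq_single j]
      · ring
      · intro k _ hk
        rw [heq u hu v hv k hk, sub_self]
      · simp
    have hu' := (Finset.mem_filter.1 (Finset.mem_filter.1 hu).1).2
    have hv' := (Finset.mem_filter.1 (Finset.mem_filter.1 hv).1).2
    have habs : |y j| * |((u j : ℕ) - (v j : ℕ) : ℝ)| ≤ 2 * δ := by
      rw [← abs_mul, ← hdiff]
      exact (abs_sub _ _).trans (by linarith)
    rw [le_div_iff₀ hr]
    calc ((u j : ℕ) - (v j : ℕ) : ℝ) * r ≤ |((u j : ℕ) - (v j : ℕ) : ℝ)| * |y j| := by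
          gcongr
          exact le_abs_self _
      _ ≤ 2 * δ := by rwa [mul_comm]
  have hsum : S.card = ∑ b, (S.filter fun u => f u = b).card :=
    Finset.card_eq_sum_card_fiberwise fun u _ => Finset.mem_coe.2 (Finset.mem_univ (f u))
  rw [hsum, Nat.cast_sum]
  refine (Finset.sum_le_sum fun b _ => hfib b).trans (le_of_eq ?_)
  simp [Fintype.card_subtype_compl, mul_add]

/-- A unit vector has a coordinate of absolute value at least the inverse square root of the
dimension. -/
lemma exists_inv_sqrt_card_le_abs {ι : Type*} [Fintype ι] (y : EuclideanSpace ℝ ι)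
    (hy : ‖y‖ = 1) : ∃ j, (√(Fintype.card ι))⁻¹ ≤ |y j| := by
  by_contra! h
  have hsum : ∑ j, y j ^ 2 = 1 := by
    have := EuclideanSpace.real_norm_sq_eq y
    rw [hy] at this
    linarith
  have hne : (Finset.univ : Finset ι).Nonempty := by
    by_contra hne
    rw [Finset.not_nonempty_iff_eq_empty] at hne
    simp [hne] at hsum
  have hcard : (0 : ℝ) < Fintype.card ι := by exact_mod_cast Finset.card_pos.2 hne
  have hlt : ∑ j, y j ^ 2 < ∑ _j : ι, (Fintype.card ι : ℝ)⁻¹ := by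
    refine Finset.sum_lt_sum_of_nonempty hne fun j _ => ?_
    calc y j ^ 2 = |y j| ^ 2 := (sq_abs _).symm
      _ < (√(Fintype.card ι))⁻¹ ^ 2 := by gcongr; exact h j
      _ = (Fintype.card ι : ℝ)⁻¹ := by rw [inv_pow, Real.sq_sqrt hcard.le]
  rw [hsum] at hlt
  simp [hcard.ne'] at hlt

/-- For a rotation-invariant measure, the slab of relative half-width `ε` orthogonal to `u` has the
same measure as the coordinate slab of half-width `ε`. -/
lemma measure_slab_eq {ι : Type*} [Fintype ι] [DecidableEq ι] (μ : Measure (EuclideanSpace ℝ ι))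
    (hinv : ∀ O : EuclideanSpace ℝ ι ≃ₗᵢ[ℝ] EuclideanSpace ℝ ι, μ.map O = μ)
    (i : ι) (ε : ℝ) {u : EuclideanSpace ℝ ι} (hu : u ≠ 0) :
    μ {y | |inner ℝ u y| ≤ ε * ‖u‖} = μ {y | |y i| ≤ ε} := by
  set e : EuclideanSpace ℝ ι := ‖u‖ • EuclideanSpace.single i 1
  have he : ‖e‖ = ‖u‖ := by simp [e, norm_smul]
  let O := (ℝ ∙ (e - u))ᗮ.reflection
  have hO : O e = u := Submodule.reflection_sub he
  conv_lhs => rw [← hinv O]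
  rw [Measure.map_apply O.continuous.measurable (measurableSet_le (by fun_prop) (by fun_prop))]
  congr 1
  ext y
  have hin : inner ℝ u (O y) = ‖u‖ * y i := by
    conv_lhs => rw [← hO]
    rw [O.inner_map_map]
    simp [e, inner_smul_left, EuclideanSpace.inner_single_left]
  simp only [Set.mem_preimage, Set.mem_ofPred_eq, hin, abs_mul, abs_norm]
  rw [mul_comm, mul_le_mul_iff_left₀ (norm_pos_iff.2 hu)]

/-- Anti-concentration of a coordinate of a uniformly distributed unit vector. -/
lemma measureReal_abs_coord_le {ι : Type*} [Fintype ι] [DecidableEq ι]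
    (μ : Measure (EuclideanSpace ℝ ι)) [IsProbabilityMeasure μ]
    (hsupp : μ (Metric.sphere (0 : EuclideanSpace ℝ ι) 1) = 1)
    (hinv : ∀ O : EuclideanSpace ℝ ι ≃ₗᵢ[ℝ] EuclideanSpace ℝ ι, μ.map O = μ)
    (i : ι) {ε : ℝ} (hε : 0 ≤ ε) :
    μ.real {y | |y i| ≤ ε} ≤ 2 * Fintype.card ι * ε := by
  set d := Fintype.card ι
  have hd : 0 < d := Fintype.card_pos_iff.2 ⟨i⟩
  have hd' : (0 : ℝ) < d := by exact_mod_cast hd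
  have hsphere : ∀ᵐ y ∂μ, ‖y‖ = 1 := by
    have := (mem_ae_iff_prob_eq_one Metric.isClosed_sphere.measurableSet).2 hsupp
    filter_upwards [this] with y hy using mem_sphere_zero_iff_norm.1 hy
  have key : ∀ N : ℕ, 0 < N → μ.real {y | |y i| ≤ ε} ≤ 2 * d * ε + 1 / N := by
    intro N hN
    have hN' : (0 : ℝ) < N := by exact_mod_cast hN
    let g : (ι → Fin N) → EuclideanSpace ℝ ι := fun u => WithLp.toLp 2 fun k => ((u k : ℕ) + 1 : ℝ)
    let E : (ι → Fin N) → Set (EuclideanSpace ℝ ι) := fun u => {y | |inner ℝ (g u) y| ≤ ε * ‖g u‖}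
    have hE : ∀ u, MeasurableSet (E u) := fun u =>
      measurableSet_le (by fun_prop) (by fun_prop)
    have hg0 : ∀ u, g u ≠ 0 := by
      intro u h
      have h' : ((u i : ℕ) + 1 : ℝ) = 0 := congrArg (fun v : EuclideanSpace ℝ ι => v i) h
      have : (0 : ℝ) ≤ (u i : ℕ) := Nat.cast_nonneg _
      linarith
    have hgN : ∀ u, ‖g u‖ ≤ N * √d := by
      intro u
      refine le_of_sq_le_sq ?_ (by positivity)
      rw [EuclideanSpace.real_norm_sq_eq, mul_pow, Real.sq_sqrt hd'.le]
      calc ∑ k, g u k ^ 2 ≤ ∑ _k : ι, (N : ℝ) ^ 2 := by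
            gcongr with k
            change ((u k : ℕ) + 1 : ℝ) ≤ N
            exact_mod_cast (u k).2
        _ = N ^ 2 * d := by simp [d, mul_comm]
    have hpt : ∀ᵐ y ∂μ, ∑ u, (E u).indicator (fun _ => (1 : ℝ)) y ≤
        (N : ℝ) ^ (d - 1) * (2 * d * ε * N + 1) := by
      filter_upwards [hsphere] with y hy
      obtain ⟨j, hj⟩ := exists_inv_sqrt_card_le_abs y hy
      have hcount := card_grid_slab_le N y j (by positivity) (by positivity : 0 ≤ ε * (N * √d)) hj
      have hle : 2 * (ε * (N * √d)) / (√d)⁻¹ = 2 * d * ε * N := by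
        rw [div_inv_eq_mul]
        linear_combination 2 * ε * N * Real.mul_self_sqrt hd'.le
      rw [hle] at hcount
      refine le_trans ?_ hcount
      simp only [Set.indicator_apply, Finset.sum_boole]
      refine Nat.cast_le.2 (Finset.card_le_card fun u hu => ?_)
      simp only [Finset.mem_filter, Finset.mem_univ, true_and] at hu ⊢
      have hu' : |inner ℝ (g u) y| ≤ ε * ‖g u‖ := hu
      rw [PiLp.inner_apply] at hu'
      exact hu'.trans (by gcongr; exact hgN u)
    have hint : ∀ u ∈ Finset.univ, Integrable ((E u).indicator fun _ => (1 : ℝ)) μ :=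
      fun u _ => (integrable_const 1).indicator (hE u)
    have hmain := integral_mono_ae (integrable_finsetSum _ hint) (integrable_const _) hpt
    rw [integral_finsetSum _ hint] at hmain
    simp only [integral_indicator_const _ (hE _), integral_const, probReal_univ, smul_eq_mul,
      mul_one, one_mul] at hmain
    have hEq : ∀ u, μ.real (E u) = μ.real {y | |y i| ≤ ε} := fun u =>
      congrArg ENNReal.toReal (measure_slab_eq μ hinv i ε (hg0 u))
    simp only [hEq, Finset.sum_const, Finset.card_univ, Fintype.card_fun, Fintype.card_fin,
      nsmul_eq_mul, Nat.cast_pow] at hmain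
    have hpow : (N : ℝ) ^ d = N ^ (d - 1) * N := (pow_sub_one_mul hd.ne' _).symm
    change (N : ℝ) ^ d * _ ≤ _ at hmain
    rw [hpow, mul_assoc] at hmain
    have h := le_of_mul_le_mul_left hmain (by positivity)
    have h2 : 2 * d * ε + 1 / N = (2 * d * ε * N + 1) / N := by field_simp
    rw [h2, le_div_iff₀ hN', mul_comm]
    exact h
  refine le_of_forall_pos_le_add fun η hη => ?_
  obtain ⟨N, hN⟩ := exists_nat_one_div_lt hη
  have := key (N + 1) N.succ_pos
  push_cast at this
  linarith

/-- Let `Y` be distributed according to the Haar (uniform) measure on the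
unit sphere of `ℝ^n` (formalized as: any probability measure concentrated on the unit sphere
that is invariant under all linear isometries, i.e. the unique rotation-invariant probability
measure). Then for all `c > 1` and any coordinate `i`,
`Pr[Y[i]² ≤ n^{-3c}] ≤ 2 n^{1-c}`. -/
theorem haar_sphere_coord_small_prob (n : ℕ) (hn : 0 < n)
    (μ : Measure (EuclideanSpace ℝ (Fin n))) [IsProbabilityMeasure μ]
    (hsupp : μ (Metric.sphere (0 : EuclideanSpace ℝ (Fin n)) 1) = 1)
    (hinv : ∀ O : EuclideanSpace ℝ (Fin n) ≃ₗᵢ[ℝ] EuclideanSpace ℝ (Fin n),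
      μ.map O = μ)
    (c : ℝ) (hc : 1 < c) (i : Fin n) :
    (μ {y : EuclideanSpace ℝ (Fin n) | y i ^ 2 ≤ (n : ℝ) ^ (-(3 * c))}).toReal
      ≤ 2 * (n : ℝ) ^ (1 - c) := by
  have hn1 : (1 : ℝ) ≤ n := by exact_mod_cast hn
  have hn0 : (0 : ℝ) < n := by linarith
  set ε : ℝ := (n : ℝ) ^ (-(3 * c / 2))
  have hε : 0 ≤ ε := by positivity
  have hεsq : (n : ℝ) ^ (-(3 * c)) = ε ^ 2 := by
    rw [← Real.rpow_mul_natCast hn0.le]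
    congr 1
    push_cast
    ring
  have hset : {y : EuclideanSpace ℝ (Fin n) | y i ^ 2 ≤ (n : ℝ) ^ (-(3 * c))} =
      {y | |y i| ≤ ε} := by
    ext y
    simp only [Set.mem_ofPred_eq, hεsq]
    rw [sq_le_sq, abs_of_nonneg hε]
  rw [hset]
  refine (measureReal_abs_coord_le μ hsupp hinv i hε).trans ?_
  rw [Fintype.card_fin, mul_assoc]
  gcongr
  calc (n : ℝ) * ε = (n : ℝ) ^ (1 + -(3 * c / 2)) := by rw [Real.rpow_add hn0, Real.rpow_one]
    _ ≤ (n : ℝ) ^ (1 - c) := Real.rpow_le_rpow_of_exponent_le hn1 (by linarith)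
end

section
/- Let {X_t}_{t≥0} be the parallel Kac's walk on the real unit sphere S^{n-1}. For sufficiently large n, c > 0, and T = 10(c+1) log n steps, the Wasserstein 1-distance between the law of X_T (from any starting point X₀) and the Haar measure μ on S^{n-1} is at most 2^{-c log n}, i.e., sup_{X₀∈S^{n-1}} W₁(L(X_T), μ) ≤ n^{-c}. -/
open MeasureTheory

/-- A perfect matching of `Fin n`, encoded as a fixed-point-free involution. -/
def PerfectMatching (n : ℕ) : Type :=
  {σ : Equiv.Perm (Fin n) // (∀ i, σ (σ i) = i) ∧ ∀ i, σ i ≠ i}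

instance (n : ℕ) : Fintype (PerfectMatching n) := by
  unfold PerfectMatching; infer_instance

instance (n : ℕ) : MeasurableSpace (PerfectMatching n) := ⊤

/-- The uniform distribution on perfect matchings of `Fin n`. -/
noncomputable def uniformPM (n : ℕ) (h : Nonempty (PerfectMatching n)) :
    Measure (PerfectMatching n) :=
  (@PMF.uniformOfFintype (PerfectMatching n) _ h).toMeasure

/-- The uniform probability measure on the angle interval `[0, 2π)`. -/
noncomputable def uniformAngle : Measure ℝ :=
  (ENNReal.ofReal (2 * Real.pi))⁻¹ • (volume.restrict (Set.Ico 0 (2 * Real.pi)))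

/-- Random seed for one step of the parallel Kac's walk: a uniformly random perfect matching
and i.i.d. uniform rotation angles (one per matched pair, read off at the smaller index). -/
abbrev KacSeed (n : ℕ) : Type := PerfectMatching n × (Fin n → ℝ)

/-- The distribution of one seed. -/
noncomputable def kacSeedMeasure (n : ℕ) (h : Nonempty (PerfectMatching n)) :
    Measure (KacSeed n) :=
  (uniformPM n h).prod (Measure.pi fun _ : Fin n => uniformAngle)

/-- One step of the parallel Kac's walk on `ℝ^n`: each matched pair `(i, σ i)` (with `i` the
smaller index) is rotated by the angle `θ i`. -/
noncomputable def kacStep {n : ℕ} (s : KacSeed n) (v : Fin n → ℝ) : Fin n → ℝ := fun i =>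
  if i ≤ s.1.1 i then Real.cos (s.2 i) * v i - Real.sin (s.2 i) * v (s.1.1 i)
  else Real.sin (s.2 (s.1.1 i)) * v (s.1.1 i) + Real.cos (s.2 (s.1.1 i)) * v i

/-- The chain `X_T` after `T` steps of the parallel Kac's walk with the given seeds. -/
noncomputable def kacWalk {n T : ℕ} (s : Fin T → KacSeed n) (x0 : Fin n → ℝ) : Fin n → ℝ :=
  (List.ofFn s).foldl (fun v seed => kacStep seed v) x0

/-- The law of `X_T` started from `x0`, as a measure on `EuclideanSpace ℝ (Fin n)`. -/
noncomputable def kacLaw (n T : ℕ) (h : Nonempty (PerfectMatching n)) (x0 : Fin n → ℝ) :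
    Measure (EuclideanSpace ℝ (Fin n)) :=
  (Measure.pi fun _ : Fin T => kacSeedMeasure n h).map
    (fun s => (WithLp.equiv 2 (Fin n → ℝ)).symm (kacWalk s x0))

/-- The Wasserstein 1-distance `W₁(μ, ν) = inf_γ E_{(x,y)∼γ} ‖x − y‖₂` over couplings `γ`. -/
noncomputable def W1 {E : Type*} [MeasurableSpace E] [NormedAddCommGroup E]
    (μ ν : Measure E) : ℝ :=
  ⨅ γ : {γ : Measure (E × E) // γ.map Prod.fst = μ ∧ γ.map Prod.snd = ν},
    ∫ p, ‖p.1 - p.2‖ ∂γ.1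

open scoped ENNReal

instance isProbabilityMeasure_uniformAngle : IsProbabilityMeasure uniformAngle := by
  refine ⟨?_⟩
  simp only [uniformAngle, Measure.smul_apply, Measure.restrict_apply_univ, Real.volume_Ico,
    sub_zero, smul_eq_mul]
  exact ENNReal.inv_mul_cancel (by simpa using Real.pi_pos) ENNReal.ofReal_ne_top

instance isProbabilityMeasure_uniformPM (n : ℕ) (h : Nonempty (PerfectMatching n)) :
    IsProbabilityMeasure (uniformPM n h) := by
  unfold uniformPM; infer_instance

instance isProbabilityMeasure_kacSeedMeasure (n : ℕ) (h : Nonempty (PerfectMatching n)) :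
    IsProbabilityMeasure (kacSeedMeasure n h) := by
  unfold kacSeedMeasure; infer_instance

/-- Reduction of an angle modulo `2π` into `[0, 2π)`. -/
noncomputable def reduceAngle (θ : ℝ) : ℝ := toIcoMod Real.two_pi_pos 0 θ

lemma measurable_reduceAngle : Measurable reduceAngle := by
  unfold reduceAngle
  simp only [toIcoMod_eq_add_fract_mul]
  fun_prop

lemma reduceAngle_eq_sub (θ : ℝ) : ∃ k : ℤ, reduceAngle θ = θ - k * (2 * Real.pi) :=
  ⟨toIcoDiv Real.two_pi_pos 0 θ, by rw [reduceAngle, toIcoMod, zsmul_eq_mul]⟩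

@[simp] lemma cos_reduceAngle (θ : ℝ) : Real.cos (reduceAngle θ) = Real.cos θ := by
  obtain ⟨k, hk⟩ := reduceAngle_eq_sub θ
  rw [hk, Real.cos_sub_int_mul_two_pi]

@[simp] lemma sin_reduceAngle (θ : ℝ) : Real.sin (reduceAngle θ) = Real.sin θ := by
  obtain ⟨k, hk⟩ := reduceAngle_eq_sub θ
  rw [hk, Real.sin_sub_int_mul_two_pi]

/-- The uniform angle is invariant under a shift followed by reduction modulo `2π`. -/
lemma measurePreserving_reduceAngle_add (φ : ℝ) :
    MeasurePreserving (fun θ => reduceAngle (θ + φ)) uniformAngle uniformAngle := by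
  have hm : Measurable (fun θ => reduceAngle (θ + φ)) :=
    measurable_reduceAngle.comp (measurable_id.add_const φ)
  refine ⟨hm, Measure.ext_of_lintegral _ fun f hf => ?_⟩
  rw [lintegral_map hf hm]
  simp only [uniformAngle, lintegral_smul_measure]
  congr 1
  have hper : ∫⁻ θ in Set.Ioc φ (φ + 2 * Real.pi), f (reduceAngle θ) =
      ∫⁻ θ in Set.Ioc 0 (0 + 2 * Real.pi), f (reduceAngle θ) := by
    refine (isAddFundamentalDomain_Ioc Real.two_pi_pos φ).setLIntegral_eq
      (isAddFundamentalDomain_Ioc Real.two_pi_pos 0) _ ?_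
    rintro ⟨g, k, rfl⟩ x
    congr 1
    simp [reduceAngle, AddSubgroup.vadd_def, toIcoMod_zsmul_add, -zsmul_eq_mul]
  calc ∫⁻ θ in Set.Ico 0 (2 * Real.pi), f (reduceAngle (θ + φ))
      = ∫⁻ θ in Set.Ioc 0 (2 * Real.pi), f (reduceAngle (θ + φ)) := by
        rw [restrict_Ico_eq_restrict_Ioc]
    _ = ∫⁻ θ in (fun x => x + φ) ⁻¹' Set.Ioc φ (φ + 2 * Real.pi), f (reduceAngle (θ + φ)) := by
        simp [Set.preimage_add_const_Ioc]
    _ = ∫⁻ θ in Set.Ioc φ (φ + 2 * Real.pi), f (reduceAngle θ) :=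
        (measurePreserving_add_right volume φ).setLIntegral_comp_preimage measurableSet_Ioc
          (hf.comp measurable_reduceAngle)
    _ = ∫⁻ θ in Set.Ico 0 (2 * Real.pi), f (reduceAngle θ) := by
        rw [hper, zero_add, restrict_Ico_eq_restrict_Ioc]
    _ = ∫⁻ θ in Set.Ico 0 (2 * Real.pi), f θ := by
        refine setLIntegral_congr_fun measurableSet_Ico fun θ hθ => ?_
        have : reduceAngle θ = θ := (toIcoMod_eq_self Real.two_pi_pos).2 (by simpa using hθ)
        simp only [this]

lemma lintegral_uniformAngle_eq_ofReal (f : ℝ → ℝ) (hf : Continuous f) (h0 : ∀ θ, 0 ≤ f θ) :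
    ∫⁻ θ, ENNReal.ofReal (f θ) ∂uniformAngle =
      ENNReal.ofReal ((2 * Real.pi)⁻¹ * ∫ θ in (0 : ℝ)..2 * Real.pi, f θ) := by
  rw [uniformAngle, lintegral_smul_measure, restrict_Ico_eq_restrict_Ioc,
    ← ofReal_integral_eq_lintegral_ofReal (hf.integrableOn_Ioc)
      (Filter.Eventually.of_forall h0), intervalIntegral.integral_of_le Real.two_pi_pos.le,
    ENNReal.ofReal_mul (inv_nonneg.2 Real.two_pi_pos.le), ENNReal.ofReal_inv_of_pos Real.two_pi_pos,
    smul_eq_mul]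

lemma lintegral_cos_pow_four :
    ∫⁻ θ, ENNReal.ofReal (Real.cos θ ^ 4) ∂uniformAngle = ENNReal.ofReal (3 / 8) := by
  rw [lintegral_uniformAngle_eq_ofReal _ (by fun_prop) fun θ => by positivity]
  congr 1
  rw [integral_cos_pow, integral_cos_pow]
  simp
  field_simp
  norm_num

lemma lintegral_sin_pow_four :
    ∫⁻ θ, ENNReal.ofReal (Real.sin θ ^ 4) ∂uniformAngle = ENNReal.ofReal (3 / 8) := by
  rw [lintegral_uniformAngle_eq_ofReal _ (by fun_prop) fun θ => by positivity]
  congr 1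
  rw [integral_sin_pow, integral_sin_pow]
  simp
  field_simp
  norm_num

/-- A step of the parallel Kac's walk that places each matched pair at a given angle on the circle
through its current position, instead of rotating it by that angle. -/
noncomputable def polarStep {n : ℕ} (s : KacSeed n) (v : Fin n → ℝ) : Fin n → ℝ := fun i =>
  if i ≤ s.1.1 i then √(v i ^ 2 + v (s.1.1 i) ^ 2) * Real.cos (s.2 i)
  else √(v i ^ 2 + v (s.1.1 i) ^ 2) * Real.sin (s.2 (s.1.1 i))

lemma kacStep_eq_polarStep {n : ℕ} (σ : PerfectMatching n) (θ : Fin n → ℝ) (v : Fin n → ℝ) :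
    kacStep (σ, θ) v =
      polarStep (σ, fun i => θ i + Complex.arg ⟨v i, v (σ.1 i)⟩) v := by
  funext i
  have key : ∀ a b : ℝ, √(a ^ 2 + b ^ 2) * Real.cos (Complex.arg ⟨a, b⟩) = a ∧
      √(a ^ 2 + b ^ 2) * Real.sin (Complex.arg ⟨a, b⟩) = b := by
    intro a b
    have hn : ‖(⟨a, b⟩ : ℂ)‖ = √(a ^ 2 + b ^ 2) := by
      rw [Complex.norm_def, Complex.normSq_mk]; ring_nf
    rw [← hn]
    exact ⟨Complex.norm_mul_cos_arg _, Complex.norm_mul_sin_arg _⟩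
  have hinv := σ.2.1 i
  by_cases hi : i ≤ σ.1 i
  · simp only [kacStep, polarStep, hi, if_true, Real.cos_add]
    obtain ⟨h1, h2⟩ := key (v i) (v (σ.1 i))
    linear_combination (-Real.cos (θ i)) * h1 + Real.sin (θ i) * h2
  · simp only [kacStep, polarStep, hi, if_false, Real.sin_add, hinv]
    obtain ⟨h1, h2⟩ := key (v (σ.1 i)) (v i)
    rw [add_comm (v (σ.1 i) ^ 2)] at h1 h2
    linear_combination (-Real.sin (θ (σ.1 i))) * h1 - Real.cos (θ (σ.1 i)) * h2

lemma polarStep_sq_add_sq {n : ℕ} (s : KacSeed n) (v : Fin n → ℝ) (i : Fin n) :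
    polarStep s v i ^ 2 + polarStep s v (s.1.1 i) ^ 2 = v i ^ 2 + v (s.1.1 i) ^ 2 := by
  have hinv := s.1.2.1 i
  have hne := s.1.2.2 i
  have h0 : 0 ≤ v i ^ 2 + v (s.1.1 i) ^ 2 := by positivity
  rcases lt_or_gt_of_ne hne with hi | hi
  · simp only [polarStep, hinv, hi.not_ge, hi.le, if_true, if_false,
      add_comm (v (s.1.1 i) ^ 2) (v i ^ 2), mul_pow, Real.sq_sqrt h0]
    linear_combination (v i ^ 2 + v (s.1.1 i) ^ 2) * Real.sin_sq_add_cos_sq (s.2 (s.1.1 i))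
  · simp only [polarStep, hinv, hi.not_ge, hi.le, if_true, if_false,
      add_comm (v (s.1.1 i) ^ 2) (v i ^ 2), mul_pow, Real.sq_sqrt h0]
    linear_combination (v i ^ 2 + v (s.1.1 i) ^ 2) * Real.sin_sq_add_cos_sq (s.2 i)

lemma sum_polarStep_sq {n : ℕ} (s : KacSeed n) (v : Fin n → ℝ) :
    ∑ i, polarStep s v i ^ 2 = ∑ i, v i ^ 2 := by
  have h := Finset.sum_congr rfl fun i (_ : i ∈ Finset.univ) => polarStep_sq_add_sq s v i
  rw [Finset.sum_add_distrib, Finset.sum_add_distrib,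
    Equiv.sum_comp s.1.1 (fun i => polarStep s v i ^ 2),
    Equiv.sum_comp s.1.1 (fun i => v i ^ 2)] at h
  linarith

lemma sum_kacStep_sq {n : ℕ} (s : KacSeed n) (v : Fin n → ℝ) :
    ∑ i, kacStep s v i ^ 2 = ∑ i, v i ^ 2 := by
  obtain ⟨σ, θ⟩ := s
  rw [kacStep_eq_polarStep, sum_polarStep_sq]

instance discreteMeasurableSpace_perfectMatching (n : ℕ) :
    DiscreteMeasurableSpace (PerfectMatching n) := ⟨fun _ => trivial⟩

lemma measurable_kacStep (n : ℕ) :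
    Measurable (fun p : KacSeed n × (Fin n → ℝ) => kacStep p.1 p.2) := by
  have h : Measurable (fun q : PerfectMatching n × ((Fin n → ℝ) × (Fin n → ℝ)) =>
      kacStep (q.1, q.2.1) q.2.2) := by
    refine measurable_from_prod_countable_right fun σ => measurable_pi_lambda _ fun i => ?_
    by_cases hi : i ≤ σ.1 i
    · simp only [kacStep, hi, if_true]; fun_prop
    · simp only [kacStep, hi, if_false]; fun_prop
  exact h.comp (by fun_prop : Measurable fun p : KacSeed n × (Fin n → ℝ) =>
    (p.1.1, (p.1.2, p.2)))

lemma measurable_polarStep (n : ℕ) :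
    Measurable (fun p : KacSeed n × (Fin n → ℝ) => polarStep p.1 p.2) := by
  have h : Measurable (fun q : PerfectMatching n × ((Fin n → ℝ) × (Fin n → ℝ)) =>
      polarStep (q.1, q.2.1) q.2.2) := by
    refine measurable_from_prod_countable_right fun σ => measurable_pi_lambda _ fun i => ?_
    by_cases hi : i ≤ σ.1 i
    · simp only [polarStep, hi, if_true]; fun_prop
    · simp only [polarStep, hi, if_false]; fun_prop
  exact h.comp (by fun_prop : Measurable fun p : KacSeed n × (Fin n → ℝ) =>
    (p.1.1, (p.1.2, p.2)))

/-- The polar step has the same law as the step of the parallel Kac's walk. -/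
lemma lintegral_kacStep {n : ℕ} (h : Nonempty (PerfectMatching n)) (v : Fin n → ℝ)
    {g : (Fin n → ℝ) → ℝ≥0∞} (hg : Measurable g) :
    ∫⁻ s, g (kacStep s v) ∂kacSeedMeasure n h = ∫⁻ s, g (polarStep s v) ∂kacSeedMeasure n h := by
  have hk : Measurable fun s : KacSeed n => g (kacStep s v) :=
    hg.comp ((measurable_kacStep n).comp (measurable_id.prodMk measurable_const))
  have hp : Measurable fun s : KacSeed n => g (polarStep s v) :=
    hg.comp ((measurable_polarStep n).comp (measurable_id.prodMk measurable_const))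
  rw [kacSeedMeasure, lintegral_prod _ hk.aemeasurable, lintegral_prod _ hp.aemeasurable]
  refine lintegral_congr fun σ => ?_
  have hmp := measurePreserving_pi (fun _ : Fin n => uniformAngle) (fun _ => uniformAngle)
    (fun i => measurePreserving_reduceAngle_add (Complex.arg ⟨v i, v (σ.1 i)⟩))
  have hshift := hmp.lintegral_comp (f := fun θ => g (polarStep (σ, θ) v))
    (hp.comp measurable_prodMk_left)
  refine Eq.trans (lintegral_congr fun θ => ?_) hshift
  rw [kacStep_eq_polarStep]
  congr 1
  funext i
  simp [polarStep]

/-- The sum over all perfect matchings of `D` at the partner of `i`, times `D i`, is nonpositive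
when `D` sums to zero, since all partners of `i` are equally likely. -/
lemma mul_sum_perfectMatching_nonpos {n : ℕ} (D : Fin n → ℝ) (hD : ∑ i, D i = 0) (i : Fin n) :
    D i * ∑ σ : PerfectMatching n, D (σ.1 i) ≤ 0 := by
  classical
  let N : Fin n → ℕ := fun j => (Finset.univ.filter fun σ : PerfectMatching n => σ.1 i = j).card
  have hsum : ∑ σ : PerfectMatching n, D (σ.1 i) = ∑ j, (N j : ℝ) * D j := by
    rw [← Finset.sum_fiberwise Finset.univ (fun σ : PerfectMatching n => σ.1 i)]
    refine Finset.sum_congr rfl fun j _ => ?_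
    rw [Finset.sum_congr rfl fun σ hσ => by rw [(Finset.mem_filter.1 hσ).2]]
    simp [N]
  have hNi : N i = 0 := by
    simp only [N, Finset.card_eq_zero, Finset.filter_eq_empty_iff]
    exact fun σ _ => σ.2.2 i
  have hle : ∀ j k, j ≠ i → k ≠ i → N j ≤ N k := by
    intro j k hj hk
    let τ := Equiv.swap j k
    have hττ : ∀ a, τ (τ a) = a := Equiv.swap_apply_self j k
    have hτi : τ i = i := Equiv.swap_apply_of_ne_of_ne hj.symm hk.symm
    refine Finset.card_le_card_of_injOn
      (fun σ => ⟨τ * σ.1 * τ, fun a => by simp [hττ, σ.2.1], fun a ha => σ.2.2 (τ a) ?_⟩) ?_ ?_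
    · have := congrArg τ ha
      simpa [hττ] using this
    · intro σ hσ
      have hσ' : σ.1 i = j := by simpa using hσ
      refine Finset.mem_coe.2 (Finset.mem_filter.2 ⟨Finset.mem_univ _, ?_⟩)
      change τ (σ.1 (τ i)) = k
      rw [hτi, hσ']
      exact Equiv.swap_apply_left j k
    · intro σ _ σ' _ h
      have h' : τ * σ.1 * τ = τ * σ'.1 * τ := congrArg Subtype.val h
      exact Subtype.ext (by simpa using h')
  obtain ⟨M, hM⟩ : ∃ M : ℕ, ∀ j, j ≠ i → N j = M := by
    by_cases hex : ∃ k, k ≠ i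
    · obtain ⟨k, hk⟩ := hex
      exact ⟨N k, fun j hj => le_antisymm (hle j k hj hk) (hle k j hk hj)⟩
    · exact ⟨0, fun j hj => absurd ⟨j, hj⟩ hex⟩
  have hval : ∑ j, (N j : ℝ) * D j = -(M * D i) := by
    have h1 : ∀ j, (N j : ℝ) * D j = M * D j - if j = i then M * D i else 0 := by
      intro j
      by_cases hj : j = i
      · subst hj; simp [hNi]
      · simp [hj, hM j hj]
    rw [Finset.sum_congr rfl fun j _ => h1 j, Finset.sum_sub_distrib, ← Finset.mul_sum, hD]
    simp
  rw [hsum, hval]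
  have : 0 ≤ (M : ℝ) * (D i * D i) := mul_nonneg M.cast_nonneg (mul_self_nonneg _)
  linarith

lemma sum_perfectMatching_pair_sq_le {n : ℕ} (D : Fin n → ℝ) (hD : ∑ i, D i = 0) :
    ∑ σ : PerfectMatching n, ∑ i, 3 / 8 * (D i + D (σ.1 i)) ^ 2 ≤
      Fintype.card (PerfectMatching n) * (3 / 4 * ∑ i, D i ^ 2) := by
  have h1 : ∀ σ : PerfectMatching n, ∑ i, 3 / 8 * (D i + D (σ.1 i)) ^ 2 =
      3 / 4 * ∑ i, D i ^ 2 + 3 / 4 * ∑ i, D i * D (σ.1 i) := by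
    intro σ
    have h2 : ∑ i, 3 / 8 * (D i + D (σ.1 i)) ^ 2 = 3 / 8 * ∑ i, D i ^ 2 +
        3 / 8 * ∑ i, D (σ.1 i) ^ 2 + 3 / 4 * ∑ i, D i * D (σ.1 i) := by
      simp only [Finset.mul_sum, ← Finset.sum_add_distrib]
      exact Finset.sum_congr rfl fun i _ => by ring
    rw [h2, Equiv.sum_comp σ.1 (fun i => D i ^ 2)]
    ring
  rw [Finset.sum_congr rfl fun σ _ => h1 σ, Finset.sum_add_distrib, Finset.sum_const,
    ← Finset.mul_sum, Finset.sum_comm]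
  have h3 : ∑ i, ∑ σ : PerfectMatching n, D i * D (σ.1 i) ≤ 0 := by
    refine Finset.sum_nonpos fun i _ => ?_
    rw [← Finset.mul_sum]
    exact mul_sum_perfectMatching_nonpos D hD i
  simp only [Finset.card_univ, nsmul_eq_mul]
  linarith

/-- The squared distance between the vectors of squared coordinates of a pair. -/
def sqDiscrepancy {n : ℕ} (p : (Fin n → ℝ) × (Fin n → ℝ)) : ℝ :=
  ∑ i, (p.1 i ^ 2 - p.2 i ^ 2) ^ 2

lemma measurable_sqDiscrepancy (n : ℕ) :
    Measurable (sqDiscrepancy : (Fin n → ℝ) × (Fin n → ℝ) → ℝ) := by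
  unfold sqDiscrepancy; fun_prop

lemma sqDiscrepancy_nonneg {n : ℕ} (p : (Fin n → ℝ) × (Fin n → ℝ)) : 0 ≤ sqDiscrepancy p :=
  Finset.sum_nonneg fun _ _ => sq_nonneg _

lemma sqDiscrepancy_le_two {n : ℕ} {x y : Fin n → ℝ} (hx : ∑ i, x i ^ 2 = 1)
    (hy : ∑ i, y i ^ 2 = 1) : sqDiscrepancy (x, y) ≤ 2 := by
  have h : sqDiscrepancy (x, y) ≤ ∑ i, (x i ^ 2 + y i ^ 2) := by
    refine Finset.sum_le_sum fun i _ => ?_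
    have h1 : x i ^ 2 ≤ 1 := hx ▸ Finset.single_le_sum (f := fun i => x i ^ 2)
      (fun _ _ => sq_nonneg _) (Finset.mem_univ i)
    have h2 : y i ^ 2 ≤ 1 := hy ▸ Finset.single_le_sum (f := fun i => y i ^ 2)
      (fun _ _ => sq_nonneg _) (Finset.mem_univ i)
    simp only
    nlinarith [sq_nonneg (x i), sq_nonneg (y i), mul_nonneg (sq_nonneg (x i)) (sq_nonneg (y i))]
  rw [Finset.sum_add_distrib, hx, hy] at h
  linarith

/-- The proportional coupling of two copies of the walk: the same matching and polar angles. -/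
noncomputable def coupledStep {n : ℕ} (s : KacSeed n) (p : (Fin n → ℝ) × (Fin n → ℝ)) :
    (Fin n → ℝ) × (Fin n → ℝ) :=
  (polarStep s p.1, polarStep s p.2)

lemma measurable_coupledStep (n : ℕ) :
    Measurable fun q : KacSeed n × ((Fin n → ℝ) × (Fin n → ℝ)) => coupledStep q.1 q.2 :=
  ((measurable_polarStep n).comp (by fun_prop : Measurable
    fun q : KacSeed n × ((Fin n → ℝ) × (Fin n → ℝ)) => (q.1, q.2.1))).prodMk
  ((measurable_polarStep n).comp (by fun_prop : Measurable
    fun q : KacSeed n × ((Fin n → ℝ) × (Fin n → ℝ)) => (q.1, q.2.2)))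

lemma polarStep_mul_nonneg {n : ℕ} (s : KacSeed n) (x y : Fin n → ℝ) (i : Fin n) :
    0 ≤ polarStep s x i * polarStep s y i := by
  by_cases hi : i ≤ s.1.1 i
  · simp only [polarStep, hi, if_true]
    rw [mul_mul_mul_comm]
    exact mul_nonneg (by positivity) (mul_self_nonneg _)
  · simp only [polarStep, hi, if_false]
    rw [mul_mul_mul_comm]
    exact mul_nonneg (by positivity) (mul_self_nonneg _)

lemma lintegral_pi_polar_coordinate {n : ℕ} (σ : PerfectMatching n)
    (x y : Fin n → ℝ) (i : Fin n) :
    ∫⁻ θ, ENNReal.ofReal ((polarStep (σ, θ) x i ^ 2 - polarStep (σ, θ) y i ^ 2) ^ 2)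
      ∂(Measure.pi fun _ : Fin n => uniformAngle) =
    ENNReal.ofReal (3 / 8 * ((x i ^ 2 - y i ^ 2) + (x (σ.1 i) ^ 2 - y (σ.1 i) ^ 2)) ^ 2) := by
  have hx : √(x i ^ 2 + x (σ.1 i) ^ 2) ^ 2 = x i ^ 2 + x (σ.1 i) ^ 2 :=
    Real.sq_sqrt (by positivity)
  have hy : √(y i ^ 2 + y (σ.1 i) ^ 2) ^ 2 = y i ^ 2 + y (σ.1 i) ^ 2 :=
    Real.sq_sqrt (by positivity)
  set A := ((x i ^ 2 - y i ^ 2) + (x (σ.1 i) ^ 2 - y (σ.1 i) ^ 2)) ^ 2 with hA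
  have hA0 : 0 ≤ A := sq_nonneg _
  have key : ∀ (j : Fin n) (f : ℝ → ℝ), Measurable f →
      (∫⁻ t, ENNReal.ofReal (f t) ∂uniformAngle = ENNReal.ofReal (3 / 8)) →
      ∫⁻ θ, ENNReal.ofReal (A * f (θ j)) ∂(Measure.pi fun _ : Fin n => uniformAngle) =
        ENNReal.ofReal (3 / 8 * A) := by
    intro j f hf hint
    have := (measurePreserving_eval (fun _ : Fin n => uniformAngle) j).lintegral_comp
      (f := fun t => ENNReal.ofReal (f t)) (by fun_prop)
    simp only [ENNReal.ofReal_mul hA0]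
    rw [lintegral_const_mul _ (by fun_prop)]
    simp only [Function.eval] at this
    rw [this, hint, mul_comm, ← ENNReal.ofReal_mul (by norm_num)]
  by_cases hi : i ≤ σ.1 i
  · rw [← key i (fun t => Real.cos t ^ 4) (by fun_prop) lintegral_cos_pow_four]
    refine lintegral_congr fun θ => ?_
    congr 1
    simp only [polarStep, hi, if_true, mul_pow, hx, hy, hA]
    ring
  · rw [← key (σ.1 i) (fun t => Real.sin t ^ 4) (by fun_prop) lintegral_sin_pow_four]
    refine lintegral_congr fun θ => ?_
    congr 1
    simp only [polarStep, hi, if_false, mul_pow, hx, hy, hA]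
    ring

/-- One step of the proportional coupling contracts the discrepancy by `3/4` on average. -/
lemma lintegral_sqDiscrepancy_coupledStep_le {n : ℕ} (h : Nonempty (PerfectMatching n))
    (p : (Fin n → ℝ) × (Fin n → ℝ)) (hp : ∑ i, p.1 i ^ 2 = ∑ i, p.2 i ^ 2) :
    ∫⁻ s, ENNReal.ofReal (sqDiscrepancy (coupledStep s p)) ∂kacSeedMeasure n h ≤
      ENNReal.ofReal (3 / 4) * ENNReal.ofReal (sqDiscrepancy p) := by
  obtain ⟨x, y⟩ := p
  have hm : Measurable fun s : KacSeed n =>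
      ENNReal.ofReal (sqDiscrepancy (coupledStep s (x, y))) :=
    ((measurable_sqDiscrepancy n).comp ((measurable_coupledStep n).comp
      (measurable_id.prodMk measurable_const))).ennreal_ofReal
  have hstep : ∀ σ : PerfectMatching n,
      ∫⁻ θ, ENNReal.ofReal (sqDiscrepancy (coupledStep (σ, θ) (x, y)))
        ∂(Measure.pi fun _ : Fin n => uniformAngle) =
      ENNReal.ofReal (∑ i, 3 / 8 *
        ((x i ^ 2 - y i ^ 2) + (x (σ.1 i) ^ 2 - y (σ.1 i) ^ 2)) ^ 2) := by
    intro σ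
    simp only [sqDiscrepancy, coupledStep]
    rw [ENNReal.ofReal_sum_of_nonneg fun i _ => by positivity]
    simp_rw [ENNReal.ofReal_sum_of_nonneg fun i (_ : i ∈ Finset.univ) =>
      sq_nonneg (polarStep (σ, _) x i ^ 2 - polarStep (σ, _) y i ^ 2)]
    rw [lintegral_finsetSum _ fun i _ => ?_]
    · exact Finset.sum_congr rfl fun i _ => lintegral_pi_polar_coordinate σ x y i
    · have hw : ∀ w : Fin n → ℝ, Measurable fun θ : Fin n → ℝ => polarStep (σ, θ) w i :=
        fun w => (measurable_pi_apply i).comp ((measurable_polarStep n).comp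
          (measurable_prodMk_left.prodMk measurable_const))
      exact (((hw x).pow_const 2).sub ((hw y).pow_const 2)).pow_const 2 |>.ennreal_ofReal
  have hcard : (0 : ℝ) < Fintype.card (PerfectMatching n) := by
    exact_mod_cast @Fintype.card_pos _ _ h
  have hD : ∑ i, (x i ^ 2 - y i ^ 2) = 0 := by
    rw [Finset.sum_sub_distrib, sub_eq_zero]; exact hp
  have hsum := sum_perfectMatching_pair_sq_le (fun i => x i ^ 2 - y i ^ 2) hD
  rw [kacSeedMeasure, lintegral_prod _ hm.aemeasurable, lintegral_congr hstep,
    lintegral_fintype]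
  have hpt : ∀ σ : PerfectMatching n, uniformPM n h {σ} =
      ENNReal.ofReal ((Fintype.card (PerfectMatching n) : ℝ)⁻¹) := by
    intro σ
    rw [uniformPM, PMF.toMeasure_apply_singleton _ _ (MeasurableSet.singleton σ),
      @PMF.uniformOfFintype_apply _ _ h, ENNReal.ofReal_inv_of_pos hcard, ENNReal.ofReal_natCast]
  simp only [hpt]
  rw [← Finset.sum_mul, ← ENNReal.ofReal_sum_of_nonneg
    (fun σ _ => Finset.sum_nonneg fun i _ => by positivity), ← ENNReal.ofReal_mul
    (Finset.sum_nonneg fun σ _ => Finset.sum_nonneg fun i _ => by positivity),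
    ← ENNReal.ofReal_mul (by norm_num)]
  refine ENNReal.ofReal_le_ofReal ?_
  rw [← div_eq_mul_inv, div_le_iff₀' hcard]
  exact hsum

section SeedWalk

variable {S X : Type*}

/-- The random-mapping walk with step function `f`, driven by the given seeds. -/
def seedWalk (f : S → X → X) {T : ℕ} (s : Fin T → S) (x : X) : X :=
  (List.ofFn s).foldl (fun v seed => f seed v) x

lemma seedWalk_cons (f : S → X → X) {T : ℕ} (a : S) (s : Fin T → S) (x : X) :
    seedWalk f (Fin.cons a s : Fin (T + 1) → S) x = seedWalk f s (f a x) := by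
  simp [seedWalk, List.ofFn_succ]

lemma seedWalk_succ (f : S → X → X) {T : ℕ} (s : Fin (T + 1) → S) (x : X) :
    seedWalk f s x = seedWalk f (Fin.tail s) (f (s 0) x) := by
  rw [← seedWalk_cons, Fin.cons_self_tail]

lemma seedWalk_mem (f : S → X → X) {A : Set X} (hA : ∀ a, ∀ x ∈ A, f a x ∈ A) {T : ℕ}
    (s : Fin T → S) : ∀ x ∈ A, seedWalk f s x ∈ A := by
  induction T with
  | zero => intro x hx; simpa [seedWalk] using hx
  | succ T ih =>
    intro x hx
    rw [seedWalk_succ]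
    exact ih _ _ (hA _ _ hx)

/-- A measure preserved by every step map is preserved by the walk. -/
lemma measurePreserving_seedWalk [MeasurableSpace X] {f : S → X → X} {ν : Measure X}
    (hν : ∀ a, MeasurePreserving (f a) ν ν) {T : ℕ} (s : Fin T → S) :
    MeasurePreserving (seedWalk f s) ν ν := by
  induction T with
  | zero => exact MeasurePreserving.id ν
  | succ T ih =>
    have h : seedWalk f s = seedWalk f (Fin.tail s) ∘ f (s 0) :=
      funext fun x => seedWalk_succ f s x
    rw [h]
    exact (ih _).comp (hν _)

variable [MeasurableSpace S] [MeasurableSpace X]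

lemma measurable_seedWalk {f : S → X → X} (hf : Measurable fun p : S × X => f p.1 p.2) (T : ℕ) :
    Measurable fun p : (Fin T → S) × X => seedWalk f p.1 p.2 := by
  induction T with
  | zero => simpa [seedWalk] using measurable_snd
  | succ T ih =>
    simp only [seedWalk_succ]
    have h1 : Measurable fun p : (Fin (T + 1) → S) × X => (Fin.tail p.1 : Fin T → S) :=
      measurable_pi_lambda _ fun i => (measurable_pi_apply i.succ).comp measurable_fst
    have h2 : Measurable fun p : (Fin (T + 1) → S) × X => (p.1 0, p.2) :=
      ((measurable_pi_apply 0).comp measurable_fst).prodMk measurable_snd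
    exact ih.comp (h1.prodMk (hf.comp h2))

lemma measurable_seedWalk_left {f : S → X → X} (hf : Measurable fun p : S × X => f p.1 p.2)
    (T : ℕ) (x : X) : Measurable fun s : Fin T → S => seedWalk f s x :=
  (measurable_seedWalk hf T).comp (measurable_id.prodMk measurable_const)

lemma lintegral_seedWalk_succ (P : Measure S) [IsProbabilityMeasure P] {f : S → X → X}
    (hf : Measurable fun p : S × X => f p.1 p.2) {g : X → ℝ≥0∞} (hg : Measurable g) (T : ℕ)
    (x : X) :
    ∫⁻ s, g (seedWalk f s x) ∂(Measure.pi fun _ : Fin (T + 1) => P) =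
      ∫⁻ a, ∫⁻ s, g (seedWalk f s (f a x)) ∂(Measure.pi fun _ : Fin T => P) ∂P := by
  have hmp := (measurePreserving_piFinSuccAbove (fun _ : Fin (T + 1) => P) 0).symm
  have hm : Measurable fun s : Fin (T + 1) → S => g (seedWalk f s x) :=
    hg.comp (measurable_seedWalk_left hf _ x)
  rw [← hmp.lintegral_comp hm]
  refine (lintegral_prod _ (hm.comp hmp.measurable).aemeasurable).trans ?_
  refine lintegral_congr fun a => lintegral_congr fun s => ?_
  simp only [MeasurableEquiv.piFinSuccAbove_symm_apply, Fin.insertNthEquiv_zero]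
  exact congrArg g (seedWalk_cons f a s x)

lemma measurable_lintegral_seedWalk (P : Measure S) [IsProbabilityMeasure P] {f : S → X → X}
    (hf : Measurable fun p : S × X => f p.1 p.2) {g : X → ℝ≥0∞} (hg : Measurable g) (T : ℕ) :
    Measurable fun x => ∫⁻ s, g (seedWalk f s x) ∂(Measure.pi fun _ : Fin T => P) :=
  Measurable.lintegral_prod_left' (hg.comp (measurable_seedWalk hf T))

/-- Two step functions with the same one-step laws have the same walk laws. -/
lemma lintegral_seedWalk_congr (P : Measure S) [IsProbabilityMeasure P] {f f' : S → X → X}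
    (hf : Measurable fun p : S × X => f p.1 p.2) (hf' : Measurable fun p : S × X => f' p.1 p.2)
    (hff' : ∀ g : X → ℝ≥0∞, Measurable g → ∀ x, ∫⁻ a, g (f a x) ∂P = ∫⁻ a, g (f' a x) ∂P)
    {g : X → ℝ≥0∞} (hg : Measurable g) (T : ℕ) :
    ∀ x, ∫⁻ s, g (seedWalk f s x) ∂(Measure.pi fun _ : Fin T => P) =
      ∫⁻ s, g (seedWalk f' s x) ∂(Measure.pi fun _ : Fin T => P) := by
  induction T with
  | zero => intro x; simp [seedWalk]
  | succ T ih =>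
    intro x
    rw [lintegral_seedWalk_succ P hf hg, lintegral_seedWalk_succ P hf' hg]
    simp only [ih]
    exact hff' _ (measurable_lintegral_seedWalk P hf' hg T) x

/-- A function contracted on average by each step decays geometrically along the walk. -/
lemma lintegral_seedWalk_le (P : Measure S) [IsProbabilityMeasure P] {f : S → X → X}
    (hf : Measurable fun p : S × X => f p.1 p.2) {g : X → ℝ≥0∞} (hg : Measurable g)
    {A : Set X} (hA : ∀ a, ∀ x ∈ A, f a x ∈ A) {c : ℝ≥0∞}
    (hc : ∀ x ∈ A, ∫⁻ a, g (f a x) ∂P ≤ c * g x) (T : ℕ) :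
    ∀ x ∈ A, ∫⁻ s, g (seedWalk f s x) ∂(Measure.pi fun _ : Fin T => P) ≤ c ^ T * g x := by
  induction T with
  | zero => intro x _; simp [seedWalk]
  | succ T ih =>
    intro x hx
    rw [lintegral_seedWalk_succ P hf hg]
    calc _ ≤ ∫⁻ a, c ^ T * g (f a x) ∂P := lintegral_mono fun a => ih _ (hA a x hx)
      _ = c ^ T * ∫⁻ a, g (f a x) ∂P := by
        rw [lintegral_const_mul]
        exact hg.comp (hf.comp (measurable_id.prodMk measurable_const))
      _ ≤ c ^ T * (c * g x) := by gcongr; exact hc x hx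
      _ = c ^ (T + 1) * g x := by rw [pow_succ, mul_assoc]

end SeedWalk

lemma seedWalk_coupledStep {n T : ℕ} (s : Fin T → KacSeed n) (x y : Fin n → ℝ) :
    seedWalk coupledStep s (x, y) = (seedWalk polarStep s x, seedWalk polarStep s y) := by
  induction T generalizing x y with
  | zero => simp [seedWalk]
  | succ T ih => rw [seedWalk_succ, seedWalk_succ, seedWalk_succ]; exact ih _ _ _

lemma lintegral_kacWalk {n : ℕ} (T : ℕ) (h : Nonempty (PerfectMatching n)) (v : Fin n → ℝ)
    {g : (Fin n → ℝ) → ℝ≥0∞} (hg : Measurable g) :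
    ∫⁻ s, g (kacWalk s v) ∂(Measure.pi fun _ : Fin T => kacSeedMeasure n h) =
      ∫⁻ s, g (seedWalk polarStep s v) ∂(Measure.pi fun _ : Fin T => kacSeedMeasure n h) :=
  lintegral_seedWalk_congr _ (measurable_kacStep n) (measurable_polarStep n)
    (fun _ hg' x => lintegral_kacStep h x hg') hg T v

lemma sum_seedWalk_polarStep_sq {n T : ℕ} (s : Fin T → KacSeed n) (v : Fin n → ℝ) :
    ∑ i, seedWalk polarStep s v i ^ 2 = ∑ i, v i ^ 2 :=
  seedWalk_mem polarStep (A := {w | ∑ i, w i ^ 2 = ∑ i, v i ^ 2})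
    (fun a w hw => (sum_polarStep_sq a w).trans hw) s v rfl

lemma seedWalk_polarStep_mul_nonneg {n T : ℕ} (hT : T ≠ 0) (s : Fin T → KacSeed n)
    (x y : Fin n → ℝ) (i : Fin n) :
    0 ≤ seedWalk polarStep s x i * seedWalk polarStep s y i := by
  obtain ⟨T, rfl⟩ := Nat.exists_eq_succ_of_ne_zero hT
  have h := seedWalk_mem coupledStep
    (A := {p : (Fin n → ℝ) × (Fin n → ℝ) | ∀ i, 0 ≤ p.1 i * p.2 i})
    (fun a p _ => polarStep_mul_nonneg a p.1 p.2) (Fin.tail s)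
    (coupledStep (s 0) (x, y)) (polarStep_mul_nonneg (s 0) x y)
  rw [← seedWalk_succ, seedWalk_coupledStep] at h
  exact h i

/-- A step of the parallel Kac's walk with fixed seed, as a linear isometry. -/
noncomputable def kacStepIsometry {n : ℕ} (s : KacSeed n) :
    EuclideanSpace ℝ (Fin n) ≃ₗᵢ[ℝ] EuclideanSpace ℝ (Fin n) :=
  LinearIsometry.toLinearIsometryEquiv
    { toFun := fun v => WithLp.toLp 2 (kacStep s v.ofLp)
      map_add' := fun v w => by
        ext i
        simp only [kacStep, PiLp.add_apply]
        split_ifs <;> ring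
      map_smul' := fun c v => by
        ext i
        simp only [kacStep, PiLp.smul_apply, smul_eq_mul, RingHom.id_apply]
        split_ifs <;> ring
      norm_map' := fun v => by
        change ‖WithLp.toLp 2 (kacStep s v.ofLp)‖ = ‖v‖
        simp only [EuclideanSpace.norm_eq, Real.norm_eq_abs, sq_abs]
        rw [sum_kacStep_sq] } rfl

lemma measurePreserving_kacStep {n : ℕ} {μ : Measure (EuclideanSpace ℝ (Fin n))}
    (hO : ∀ O : EuclideanSpace ℝ (Fin n) ≃ₗᵢ[ℝ] EuclideanSpace ℝ (Fin n), μ.map O = μ)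
    (s : KacSeed n) :
    MeasurePreserving (kacStep s) (μ.map WithLp.ofLp) (μ.map WithLp.ofLp) := by
  have hof : Measurable (WithLp.ofLp : EuclideanSpace ℝ (Fin n) → Fin n → ℝ) :=
    WithLp.measurable_ofLp 2 _
  have hk : Measurable (kacStep s) :=
    (measurable_kacStep n).comp (measurable_const.prodMk measurable_id)
  refine ⟨hk, ?_⟩
  conv_rhs => rw [← hO (kacStepIsometry s)]
  rw [Measure.map_map hk hof, Measure.map_map hof (kacStepIsometry s).continuous.measurable]
  rfl

lemma sum_sub_sq_le_sqrt {n : ℕ} (x y : Fin n → ℝ) (h : ∀ i, 0 ≤ x i * y i) :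
    (∑ i, (x i - y i) ^ 2) ^ 2 ≤ n * sqDiscrepancy (x, y) := by
  calc (∑ i, (x i - y i) ^ 2) ^ 2 ≤ n * ∑ i, ((x i - y i) ^ 2) ^ 2 := by
        simpa using sq_sum_le_card_mul_sum_sq (s := Finset.univ) (f := fun i => (x i - y i) ^ 2)
    _ ≤ n * sqDiscrepancy (x, y) := by
        refine mul_le_mul_of_nonneg_left (Finset.sum_le_sum fun i _ => ?_) n.cast_nonneg
        simp only
        nlinarith [mul_nonneg (h i) (sq_nonneg (x i - y i))]

lemma le_of_pow_four_le {z a B : ℝ} (ha : 0 < a) (hz : z ^ 4 ≤ B) :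
    z ≤ 3 / 4 * a + B / (4 * a ^ 3) := by
  have h : z * (4 * a ^ 3) ≤ 3 * a ^ 4 + z ^ 4 := by
    nlinarith [mul_nonneg (sq_nonneg (z - a)) (add_nonneg (sq_nonneg (z + a)) (sq_nonneg a)),
      sq_nonneg (z - a), mul_nonneg (sq_nonneg (z - a)) (sq_nonneg a)]
  have h' : z ≤ (3 * a ^ 4 + B) / (4 * a ^ 3) := by
    rw [le_div_iff₀ (by positivity)]; linarith
  refine h'.trans_eq ?_
  field_simp

/-- Bound on the Wasserstein distance obtained from the proportional coupling. -/
lemma W1_kacLaw_le {n T : ℕ} (hT : T ≠ 0) (h : Nonempty (PerfectMatching n)) (x0 : Fin n → ℝ)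
    (hx0 : ∑ i, x0 i ^ 2 = 1) (μ : Measure (EuclideanSpace ℝ (Fin n))) [IsProbabilityMeasure μ]
    (hμ : μ (Metric.sphere (0 : EuclideanSpace ℝ (Fin n)) 1) = 1)
    (hO : ∀ O : EuclideanSpace ℝ (Fin n) ≃ₗᵢ[ℝ] EuclideanSpace ℝ (Fin n), μ.map O = μ)
    {a : ℝ} (ha : 0 < a) (hbound : n * (2 * (3 / 4 : ℝ) ^ T) ≤ a ^ 4) :
    W1 (kacLaw n T h x0) μ ≤ a := by
  have hof : Measurable (WithLp.ofLp : EuclideanSpace ℝ (Fin n) → Fin n → ℝ) :=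
    WithLp.measurable_ofLp 2 _
  have hto : Measurable (WithLp.toLp 2 : (Fin n → ℝ) → EuclideanSpace ℝ (Fin n)) :=
    WithLp.measurable_toLp 2 _
  set ν : Measure (Fin n → ℝ) := μ.map WithLp.ofLp with hν
  have : IsProbabilityMeasure ν := Measure.isProbabilityMeasure_map hof.aemeasurable
  set P : Measure (Fin T → KacSeed n) := Measure.pi fun _ => kacSeedMeasure n h with hP
  let W : (Fin T → KacSeed n) → (Fin n → ℝ) → (Fin n → ℝ) := fun s => seedWalk polarStep s
  have hW : Measurable fun p : (Fin T → KacSeed n) × (Fin n → ℝ) => W p.1 p.2 :=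
    measurable_seedWalk (measurable_polarStep n) T
  have hK : Measurable fun p : (Fin T → KacSeed n) × (Fin n → ℝ) => kacWalk p.1 p.2 :=
    measurable_seedWalk (measurable_kacStep n) T
  have hΦ1 : Measurable fun ω : (Fin T → KacSeed n) × (Fin n → ℝ) =>
      WithLp.toLp 2 (W ω.1 x0) := hto.comp (hW.comp (measurable_fst.prodMk measurable_const))
  have hΦ2 : Measurable fun ω : (Fin T → KacSeed n) × (Fin n → ℝ) =>
      WithLp.toLp 2 (W ω.1 ω.2) := hto.comp hW
  have hΦ := hΦ1.prodMk hΦ2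
  set γ := (P.prod ν).map fun ω : (Fin T → KacSeed n) × (Fin n → ℝ) =>
    (WithLp.toLp 2 (W ω.1 x0), WithLp.toLp 2 (W ω.1 ω.2)) with hγ
  have hfst : γ.map Prod.fst = kacLaw n T h x0 := by
    rw [hγ, Measure.map_map measurable_fst hΦ]
    refine Measure.ext_of_lintegral _ fun g hg => ?_
    have hK0 : Measurable fun s : Fin T → KacSeed n =>
        (WithLp.equiv 2 (Fin n → ℝ)).symm (kacWalk s x0) :=
      hto.comp (hK.comp (measurable_id.prodMk measurable_const))
    rw [lintegral_map hg (measurable_fst.comp hΦ), kacLaw, lintegral_map hg hK0]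
    refine Eq.trans ?_ (lintegral_kacWalk T h x0 (hg.comp hto)).symm
    refine (lintegral_prod _ (hg.comp (measurable_fst.comp hΦ)).aemeasurable).trans ?_
    simp [W, hP]
  have hsnd : γ.map Prod.snd = μ := by
    rw [hγ, Measure.map_map measurable_snd hΦ]
    refine Measure.ext_of_lintegral _ fun g hg => ?_
    have hg' := hg.comp hto
    rw [lintegral_map hg (measurable_snd.comp hΦ)]
    refine (lintegral_prod_symm _ (hg.comp (measurable_snd.comp hΦ)).aemeasurable).trans ?_
    calc _ = ∫⁻ y, ∫⁻ s, g (WithLp.toLp 2 (kacWalk s y)) ∂P ∂ν :=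
          lintegral_congr fun y => (lintegral_kacWalk T h y hg').symm
      _ = ∫⁻ s, ∫⁻ y, g (WithLp.toLp 2 (kacWalk s y)) ∂ν ∂P :=
          lintegral_lintegral_swap
            ((hg'.comp hK).comp measurable_swap).aemeasurable
      _ = ∫⁻ s, ∫⁻ y, g (WithLp.toLp 2 y) ∂ν ∂P :=
          lintegral_congr fun s => (measurePreserving_seedWalk
            (fun a => measurePreserving_kacStep hO a) s).lintegral_comp hg'
      _ = ∫⁻ y, g y ∂μ := by
          rw [lintegral_const, measure_univ, mul_one]
          exact lintegral_map hg' hof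
  have hsphere : ∀ᵐ y ∂ν, ∑ i, y i ^ 2 = 1 := by
    rw [hν, ae_map_iff hof.aemeasurable (measurableSet_eq_fun (by fun_prop) measurable_const)]
    have hae : ∀ᵐ v ∂μ, v ∈ Metric.sphere (0 : EuclideanSpace ℝ (Fin n)) 1 :=
      (prob_compl_eq_zero_iff Metric.isClosed_sphere.measurableSet).2 hμ
    filter_upwards [hae] with v hv
    have h1 : ‖v‖ ^ 2 = 1 := by rw [mem_sphere_zero_iff_norm.1 hv]; norm_num
    rw [EuclideanSpace.norm_sq_eq] at h1
    simpa using h1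
  have hcontr : ∀ᵐ y ∂ν, ∫⁻ s, ENNReal.ofReal (sqDiscrepancy (W s x0, W s y)) ∂P ≤
      ENNReal.ofReal (2 * (3 / 4) ^ T) := by
    filter_upwards [hsphere] with y hy
    have hw := lintegral_seedWalk_le (kacSeedMeasure n h) (measurable_coupledStep n)
      (measurable_sqDiscrepancy n).ennreal_ofReal
      (A := {p | ∑ i, p.1 i ^ 2 = ∑ i, p.2 i ^ 2})
      (fun s p hp => by
        simpa only [coupledStep, Set.mem_ofPred_eq, sum_polarStep_sq] using hp)
      (fun p hp => lintegral_sqDiscrepancy_coupledStep_le h p hp) T (x0, y) (hx0.trans hy.symm)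
    simp only [seedWalk_coupledStep] at hw
    refine hw.trans ?_
    rw [← ENNReal.ofReal_pow (by norm_num), ← ENNReal.ofReal_mul (by positivity), mul_comm 2]
    exact ENNReal.ofReal_le_ofReal
      (mul_le_mul_of_nonneg_left (sqDiscrepancy_le_two hx0 hy) (by positivity))
  have hdist : ∀ s y, ‖(WithLp.toLp 2 (W s x0) : EuclideanSpace ℝ (Fin n)) -
      WithLp.toLp 2 (W s y)‖ ≤
        3 / 4 * a + n / (4 * a ^ 3) * sqDiscrepancy (W s x0, W s y) := by
    intro s y
    have h4 : ‖(WithLp.toLp 2 (W s x0) : EuclideanSpace ℝ (Fin n)) - WithLp.toLp 2 (W s y)‖ ^ 4 ≤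
        n * sqDiscrepancy (W s x0, W s y) := by
      refine le_trans (le_of_eq ?_) (sum_sub_sq_le_sqrt (W s x0) (W s y)
        (seedWalk_polarStep_mul_nonneg hT s x0 y))
      rw [show (4 : ℕ) = 2 * 2 from rfl, pow_mul, EuclideanSpace.norm_sq_eq]
      simp
    refine (le_of_pow_four_le ha h4).trans_eq ?_
    ring
  have hint : ∫ p, ‖p.1 - p.2‖ ∂γ ≤ a := by
    rw [integral_eq_lintegral_of_nonneg_ae (Filter.Eventually.of_forall fun _ => norm_nonneg _)
      (by fun_prop)]
    refine ENNReal.toReal_le_of_le_ofReal ha.le ?_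
    rw [hγ, lintegral_map (by fun_prop) hΦ]
    have hS : Measurable fun ω : (Fin T → KacSeed n) × (Fin n → ℝ) =>
        ENNReal.ofReal (sqDiscrepancy (W ω.1 x0, W ω.1 ω.2)) :=
      ((measurable_sqDiscrepancy n).comp
        ((hW.comp (measurable_fst.prodMk measurable_const)).prodMk hW)).ennreal_ofReal
    calc _ ≤ ∫⁻ ω, (ENNReal.ofReal (3 / 4 * a) + ENNReal.ofReal (n / (4 * a ^ 3)) *
          ENNReal.ofReal (sqDiscrepancy (W ω.1 x0, W ω.1 ω.2))) ∂(P.prod ν) := by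
          refine lintegral_mono fun ω => ?_
          rw [← ENNReal.ofReal_mul (by positivity), ← ENNReal.ofReal_add (by positivity)
            (mul_nonneg (by positivity) (sqDiscrepancy_nonneg _))]
          exact ENNReal.ofReal_le_ofReal (hdist ω.1 ω.2)
      _ = ENNReal.ofReal (3 / 4 * a) + ENNReal.ofReal (n / (4 * a ^ 3)) *
          ∫⁻ y, ∫⁻ s, ENNReal.ofReal (sqDiscrepancy (W s x0, W s y)) ∂P ∂ν := by
          rw [lintegral_add_left measurable_const, lintegral_const, measure_univ, mul_one,
            lintegral_const_mul _ hS, lintegral_prod_symm _ hS.aemeasurable]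
      _ ≤ ENNReal.ofReal (3 / 4 * a) + ENNReal.ofReal (n / (4 * a ^ 3)) *
          ENNReal.ofReal (2 * (3 / 4) ^ T) := by
          gcongr
          refine (lintegral_mono_ae hcontr).trans ?_
          simp
      _ ≤ ENNReal.ofReal a := by
          rw [← ENNReal.ofReal_mul (by positivity), ← ENNReal.ofReal_add (by positivity)
            (by positivity)]
          refine ENNReal.ofReal_le_ofReal ?_
          have : (n : ℝ) / (4 * a ^ 3) * (2 * (3 / 4) ^ T) ≤ a / 4 := by
            rw [div_mul_eq_mul_div, div_le_iff₀ (by positivity)]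
            refine hbound.trans_eq ?_
            ring
          linarith
  refine (ciInf_le ⟨0, ?_⟩ ⟨γ, hfst, hsnd⟩).trans hint
  rintro _ ⟨γ', rfl⟩
  exact integral_nonneg fun _ => norm_nonneg _

lemma three_fourths_pow_le {c : ℝ} (hc : 0 < c) {n : ℕ} (hn : 2 ≤ n) :
    n * (2 * (3 / 4 : ℝ) ^ ⌈10 * (c + 1) * Real.logb 2 n⌉₊) ≤ ((n : ℝ) ^ (-c)) ^ 4 := by
  have hn' : (2 : ℝ) ≤ n := by exact_mod_cast hn
  have hn0 : (0 : ℝ) < n := by linarith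
  set L := Real.logb 2 n with hL
  have hnL : (2 : ℝ) ^ L = n := Real.rpow_logb (by norm_num) (by norm_num) hn0
  have hL1 : 1 ≤ L := by
    rw [hL, Real.le_logb_iff_rpow_le (by norm_num) hn0]; simpa using hn'
  have hbase : (3 / 4 : ℝ) ≤ (2 : ℝ) ^ (-(2 / 5) : ℝ) := by
    refine le_of_pow_le_pow_left₀ (n := 5) (by norm_num) (by positivity) ?_
    rw [← Real.rpow_mul_natCast (by norm_num)]
    norm_num
  have hpow : (3 / 4 : ℝ) ^ ⌈10 * (c + 1) * L⌉₊ ≤ (2 : ℝ) ^ (-(4 * (c + 1) * L)) := by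
    rw [← Real.rpow_natCast]
    calc (3 / 4 : ℝ) ^ ((⌈10 * (c + 1) * L⌉₊ : ℕ) : ℝ)
        ≤ (3 / 4 : ℝ) ^ (10 * (c + 1) * L) :=
          Real.rpow_le_rpow_of_exponent_ge (by norm_num) (by norm_num) (Nat.le_ceil _)
      _ ≤ ((2 : ℝ) ^ (-(2 / 5) : ℝ)) ^ (10 * (c + 1) * L) :=
          Real.rpow_le_rpow (by norm_num) hbase (by positivity)
      _ = (2 : ℝ) ^ (-(4 * (c + 1) * L)) := by
          rw [← Real.rpow_mul (by norm_num)]; ring_nf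
  calc n * (2 * (3 / 4 : ℝ) ^ ⌈10 * (c + 1) * L⌉₊)
      ≤ (2 : ℝ) ^ L * ((2 : ℝ) ^ (1 : ℝ) * (2 : ℝ) ^ (-(4 * (c + 1) * L))) := by
        rw [hnL, Real.rpow_one]; gcongr
    _ = (2 : ℝ) ^ (L + (1 + -(4 * (c + 1) * L))) := by
        rw [Real.rpow_add (by norm_num), Real.rpow_add (by norm_num)]
    _ ≤ (2 : ℝ) ^ (L * -c * 4) :=
        Real.rpow_le_rpow_of_exponent_le (by norm_num) (by nlinarith)
    _ = ((n : ℝ) ^ (-c)) ^ 4 := by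
        rw [Real.rpow_mul (by norm_num), Real.rpow_mul (by norm_num), hnL]
        norm_cast

/-- For every `c > 0` and sufficiently large (even) `n`, after
`T = 10(c+1) log₂ n` steps the parallel Kac's walk on the real unit sphere satisfies
`W₁(L(X_T), μ) ≤ 2^{-c log₂ n} = n^{-c}` from any starting point, where `μ` is the Haar
(rotation-invariant) probability measure on the unit sphere. -/
theorem kacWalk_W1_mixing :
    ∀ c : ℝ, 0 < c → ∃ N : ℕ, ∀ n : ℕ, N ≤ n → ∀ m : ℕ, n = 2 * m →
    ∀ h : Nonempty (PerfectMatching n),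
    ∀ x0 : Fin n → ℝ, (∑ i, x0 i ^ 2 = 1) →
    ∀ μ : Measure (EuclideanSpace ℝ (Fin n)), IsProbabilityMeasure μ →
      μ (Metric.sphere (0 : EuclideanSpace ℝ (Fin n)) 1) = 1 →
      (∀ O : EuclideanSpace ℝ (Fin n) ≃ₗᵢ[ℝ] EuclideanSpace ℝ (Fin n), μ.map O = μ) →
      W1 (kacLaw n (⌈10 * (c + 1) * Real.logb 2 n⌉₊) h x0) μ ≤ (n : ℝ) ^ (-c) := by
  intro c hc
  refine ⟨2, fun n hn m _ h x0 hx0 μ hμ hsphere hO => ?_⟩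
  have hn' : (2 : ℝ) ≤ n := by exact_mod_cast hn
  refine W1_kacLaw_le ?_ h x0 hx0 μ hsphere hO (Real.rpow_pos_of_pos (by linarith) _)
    (three_fourths_pow_le hc hn)
  have hlog : 0 < Real.logb 2 n := Real.logb_pos (by norm_num) (by linarith)
  exact (Nat.ceil_pos.2 (by positivity)).ne'
end
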